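/- Fix β ∈ (0,1) and ε > 0, and let s_ε(ρ) = β ∫₀^ρ (x²+ε)^{(β−1)/2} dx. Then for every ρ > 0 one has the strict inequality (ρ²+ε)^{(1−β)/2} · s_ε(ρ) < ρ. Equivalently, the coefficient a_ε(ρ) = β²ρ²/((ρ²+ε)^{1−β} s_ε(ρ)²) of the perturbed cone metric in polar coordinates satisfies a_ε(ρ) > β² for every ρ > 0. -/

import Mathlib

open intervalIntegral

/-- The radial arclength coordinate `s_ε(ρ) = β ∫₀^ρ (x²+ε)^{(β−1)/2} dx` of the
perturbed cone metric `β²(|z|²+ε)^{β−1}|dz|²` (real powers). -/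
noncomputable def sGP (β ε ρ : ℝ) : ℝ :=
  β * ∫ x in (0:ℝ)..ρ, (x ^ 2 + ε) ^ ((β - 1) / 2)

theorem continuous_sq_add_rpow {ε : ℝ} (hε : 0 < ε) (p : ℝ) :
    Continuous fun x : ℝ => (x ^ 2 + ε) ^ p :=
  Continuous.rpow_const (by fun_prop) fun x => Or.inl (by positivity)

theorem hasDerivAt_sGP (β : ℝ) {ε : ℝ} (hε : 0 < ε) (ρ : ℝ) :
    HasDerivAt (sGP β ε) (β * (ρ ^ 2 + ε) ^ ((β - 1) / 2)) ρ :=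
  ((continuous_sq_add_rpow hε _).integral_hasStrictDerivAt 0 ρ).hasDerivAt.const_mul β

theorem hasDerivAt_mul_sq_add_rpow {ε : ℝ} (hε : 0 < ε) (p x : ℝ) :
    HasDerivAt (fun x : ℝ => x * (x ^ 2 + ε) ^ p)
      ((x ^ 2 + ε) ^ (p - 1) * ((2 * p + 1) * x ^ 2 + ε)) x := by
  have hpos : 0 < x ^ 2 + ε := by positivity
  have hbase : HasDerivAt (fun x : ℝ => x ^ 2 + ε) (2 * x) x := by
    simpa using (hasDerivAt_pow 2 x).add_const ε
  refine ((hasDerivAt_id x).mul (hbase.rpow_const (p := p) (Or.inl hpos.ne'))).congr_deriv ?_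
  have hp : (x ^ 2 + ε) ^ p = (x ^ 2 + ε) ^ (p - 1) * (x ^ 2 + ε) := by
    rw [← Real.rpow_add_one hpos.ne', sub_add_cancel]
  simp only [id_eq, hp]
  ring

theorem sGP_pos {β ε ρ : ℝ} (hβ : 0 < β) (hε : 0 < ε) (hρ : 0 < ρ) : 0 < sGP β ε ρ :=
  mul_pos hβ <| intervalIntegral_pos_of_pos
    ((continuous_sq_add_rpow hε _).intervalIntegrable 0 ρ) (fun x => by positivity) hρ

theorem sGP_lt_mul_rpow {β ε ρ : ℝ} (hβ1 : β < 1) (hε : 0 < ε) (hρ : 0 < ρ) :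
    sGP β ε ρ < ρ * (ρ ^ 2 + ε) ^ ((β - 1) / 2) := by
  have hderiv (x : ℝ) := (hasDerivAt_mul_sq_add_rpow hε ((β - 1) / 2) x).sub
    (hasDerivAt_sGP β hε x)
  have hmono := strictMono_of_hasDerivAt_pos hderiv fun x => by
    have hpos : 0 < x ^ 2 + ε := by positivity
    have hp : (x ^ 2 + ε) ^ ((β - 1) / 2) =
        (x ^ 2 + ε) ^ ((β - 1) / 2 - 1) * (x ^ 2 + ε) := by
      rw [← Real.rpow_add_one hpos.ne', sub_add_cancel]
    have hmul : 0 < (x ^ 2 + ε) ^ ((β - 1) / 2 - 1) * ((1 - β) * ε) :=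
      mul_pos (Real.rpow_pos_of_pos hpos _) (mul_pos (sub_pos.2 hβ1) hε)
    rw [hp]
    linear_combination hmul
  have hlt := hmono hρ
  simpa [sGP] using hlt

/-- Fix `β ∈ (0,1)` and `ε > 0`. Then for every `ρ > 0` one has the strict
inequality `(ρ²+ε)^{(1−β)/2} · s_ε(ρ) < ρ`. Equivalently, the coefficient
`a_ε(ρ) = β²ρ²/((ρ²+ε)^{1−β} s_ε(ρ)²)` satisfies `a_ε(ρ) > β²` for every `ρ > 0`. -/
theorem sGP_strict_upper_bound (β ε : ℝ) (hβ : 0 < β) (hβ1 : β < 1) (hε : 0 < ε) :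
    (∀ ρ > (0:ℝ), (ρ ^ 2 + ε) ^ ((1 - β) / 2) * sGP β ε ρ < ρ) ∧
    (∀ ρ > (0:ℝ),
      β ^ 2 < β ^ 2 * ρ ^ 2 / ((ρ ^ 2 + ε) ^ (1 - β) * (sGP β ε ρ) ^ 2)) := by
  have hlt (ρ : ℝ) (hρ : 0 < ρ) : (ρ ^ 2 + ε) ^ ((1 - β) / 2) * sGP β ε ρ < ρ := by
    have hpos : 0 < ρ ^ 2 + ε := by positivity
    calc (ρ ^ 2 + ε) ^ ((1 - β) / 2) * sGP β ε ρ
        < (ρ ^ 2 + ε) ^ ((1 - β) / 2) * (ρ * (ρ ^ 2 + ε) ^ ((β - 1) / 2)) :=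
          mul_lt_mul_of_pos_left (sGP_lt_mul_rpow hβ1 hε hρ) (Real.rpow_pos_of_pos hpos _)
      _ = ρ * (ρ ^ 2 + ε) ^ ((1 - β) / 2 + (β - 1) / 2) := by
          rw [Real.rpow_add hpos]; ring
      _ = ρ := by
          rw [show (1 - β) / 2 + (β - 1) / 2 = 0 by ring, Real.rpow_zero, mul_one]
  refine ⟨hlt, fun ρ hρ => ?_⟩
  have hpos : 0 < ρ ^ 2 + ε := by positivity
  have hs := sGP_pos hβ hε hρ
  have hsq : (ρ ^ 2 + ε) ^ (1 - β) * sGP β ε ρ ^ 2 =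
      ((ρ ^ 2 + ε) ^ ((1 - β) / 2) * sGP β ε ρ) ^ 2 := by
    rw [mul_pow, ← Real.rpow_mul_natCast hpos.le]
    norm_num
  rw [hsq, lt_div_iff₀ (by positivity)]
  have := hlt ρ hρ
  gcongr
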